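/- Let F be a field, let Ω be a tree quiver, and let V be an indecomposable representation of Ω over F. Then the support of V, i.e. the set of vertices i with V(i) ≠ 0, is connected: any two vertices in the support are joined by a walk in the underlying graph all of whose vertices lie in the support. -/

import Mathlib

/-- A quiver: a set of vertices, a set of arrows, with source and target maps. -/
structure Quiv : Type 1 where
  V : Type
  A : Type
  s : A → V
  t : A → V

/-- A representation of a quiver over a field `F`. -/
structure QRep (F : Type) [Field F] (Q : Quiv) : Type 1 where
  M : Q.V → Type
  [acg : ∀ i, AddCommGroup (M i)]
  [mod : ∀ i, Module F (M i)]
  map : ∀ a : Q.A, M (Q.s a) →ₗ[F] M (Q.t a)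

attribute [instance] QRep.acg QRep.mod

namespace QRep

variable {F : Type} [Field F] {Q : Quiv}

/-- A representation is nonzero if some vertex space has a nonzero vector. -/
def Nonzero (V : QRep F Q) : Prop := ∃ i, ∃ x : V.M i, x ≠ 0

/-- A morphism of representations. -/
structure Hom (V W : QRep F Q) : Type where
  app : ∀ i, V.M i →ₗ[F] W.M i
  comm : ∀ a : Q.A, (W.map a).comp (app (Q.s a)) = (app (Q.t a)).comp (V.map a)

/-- A morphism is an isomorphism iff it is bijective at each vertex. -/
def Hom.IsIso {V W : QRep F Q} (f : Hom V W) : Prop := ∀ i, Function.Bijective (f.app i)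

/-- Two representations are isomorphic. -/
def Iso (V W : QRep F Q) : Prop := ∃ f : Hom V W, f.IsIso

/-- The (external) direct sum of two representations. -/
def dsum (V W : QRep F Q) : QRep F Q where
  M i := V.M i × W.M i
  map a := (V.map a).prodMap (W.map a)

/-- A representation is indecomposable if it is nonzero and not isomorphic to a direct
sum of two nonzero representations. -/
def Indec (V : QRep F Q) : Prop :=
  V.Nonzero ∧ ∀ A B : QRep F Q, A.Nonzero → B.Nonzero → ¬ Iso V (dsum A B)

/-- FLEI: locally finite-dimensional, and all but finitely many arrow maps are
isomorphisms. -/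
def IsFLEI (V : QRep F Q) : Prop :=
  (∀ i, FiniteDimensional F (V.M i)) ∧ {a : Q.A | ¬ Function.Bijective (V.map a)}.Finite

end QRep

/-- A subrepresentation: a subspace at each vertex, stable under the arrow maps. -/
structure Subrep {F : Type} [Field F] {Q : Quiv} (V : QRep F Q) : Type where
  S : ∀ i, Submodule F (V.M i)
  stable : ∀ a : Q.A, ∀ x ∈ S (Q.s a), V.map a x ∈ S (Q.t a)

namespace Subrep

variable {F : Type} [Field F] {Q : Quiv} {V : QRep F Q}

/-- A subrepresentation, viewed as a representation in its own right. -/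
def toRep (W : Subrep V) : QRep F Q where
  M i := ↥(W.S i)
  map a := (V.map a).restrict (W.stable a)

/-- The quotient of a representation by a subrepresentation. -/
def quot (W : Subrep V) : QRep F Q where
  M i := V.M i ⧸ W.S i
  map a := Submodule.mapQ _ _ (V.map a) (fun x hx => W.stable a x hx)

end Subrep
/-- Adjacency in the underlying graph of a quiver. -/
def Quiv.Adj (Q : Quiv) (i j : Q.V) : Prop :=
  ∃ a : Q.A, (Q.s a = i ∧ Q.t a = j) ∨ (Q.s a = j ∧ Q.t a = i)

/-- The underlying graph is connected. -/
def Quiv.Connected (Q : Quiv) : Prop :=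
  ∀ i j : Q.V, Relation.ReflTransGen Q.Adj i j

/-- Source of an oriented edge-traversal (arrow plus direction of traversal). -/
def Quiv.esrc (Q : Quiv) (p : Q.A × Bool) : Q.V := if p.2 then Q.s p.1 else Q.t p.1

/-- Target of an oriented edge-traversal. -/
def Quiv.etgt (Q : Quiv) (p : Q.A × Bool) : Q.V := if p.2 then Q.t p.1 else Q.s p.1

/-- `e 0, …, e (n-1)` is a cycle: a closed walk of positive length in the underlying
graph traversing no edge twice. -/
def Quiv.IsCycle (Q : Quiv) (n : ℕ) (e : ℕ → Q.A × Bool) : Prop :=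
  0 < n ∧ (∀ k < n, Q.etgt (e k) = Q.esrc (e ((k + 1) % n))) ∧
    (∀ j < n, ∀ k < n, (e j).1 = (e k).1 → j = k)

/-- The quiver has no cycles in its underlying graph. -/
def Quiv.NoCycles (Q : Quiv) : Prop := ¬ ∃ (n : ℕ) (e : ℕ → Q.A × Bool), Q.IsCycle n e

/-- A tree quiver: connected underlying graph with no cycles. -/
def Quiv.IsTree (Q : Quiv) : Prop := Q.Connected ∧ Q.NoCycles

/-- The support of a representation: vertices where the space is nonzero. -/
def QRep.supp {F : Type} [Field F] {Q : Quiv} (V : QRep F Q) : Set Q.V :=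
  {i | ∃ x : V.M i, x ≠ 0}

namespace Subrep

variable {F : Type} [Field F] {Q : Quiv} {V : QRep F Q}

/-- A representation is the direct sum of two complementary subrepresentations. -/
theorem iso_dsum_of_isCompl (A B : Subrep V) (h : ∀ i, IsCompl (A.S i) (B.S i)) :
    V.Iso (A.toRep.dsum B.toRep) := by
  refine ⟨⟨fun i => (Submodule.prodEquivOfIsCompl _ _ (h i)).symm.toLinearMap, fun a => ?_⟩,
    fun i => (Submodule.prodEquivOfIsCompl _ _ (h i)).symm.bijective⟩
  refine LinearMap.ext fun x => ?_
  obtain ⟨y, rfl⟩ := (Submodule.prodEquivOfIsCompl _ _ (h (Q.s a))).surjective x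
  change (A.toRep.dsum B.toRep).map a
      ((Submodule.prodEquivOfIsCompl _ _ (h (Q.s a))).symm
        (Submodule.prodEquivOfIsCompl _ _ (h (Q.s a)) y)) =
    (Submodule.prodEquivOfIsCompl _ _ (h (Q.t a))).symm
      (V.map a (Submodule.prodEquivOfIsCompl _ _ (h (Q.s a)) y))
  rw [LinearEquiv.symm_apply_apply]
  refine ((LinearEquiv.symm_apply_eq _).2 ?_).symm
  exact map_add (V.map a) (y.1 : V.M (Q.s a)) (y.2 : V.M (Q.s a))

/-- The subrepresentation supported on a set of vertices that no arrow with nonzero ends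
leaves. -/
def ofSet (V : QRep F Q) (P : Set Q.V)
    (hP : ∀ a, Q.s a ∈ V.supp → Q.t a ∈ V.supp → Q.s a ∈ P → Q.t a ∈ P) : Subrep V where
  S i := ⨆ _ : i ∈ P, ⊤
  stable a x hx := by
    by_cases ht : Q.t a ∈ P
    · simp [ht]
    by_cases hs : Q.s a ∈ P
    · have : V.map a x = 0 := by
        by_contra hne
        exact ht (hP a ⟨x, fun h => hne (by simp [h])⟩ ⟨_, hne⟩ hs)
      simp [this]
    · have : x = 0 := by simpa [hs] using hx
      simp [this]

theorem isCompl_ofSet_compl (P : Set Q.V) (hP hPc) (i : Q.V) :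
    IsCompl ((ofSet V P hP).S i) ((ofSet V Pᶜ hPc).S i) := by
  by_cases h : i ∈ P
  · simpa [ofSet, h] using isCompl_top_bot
  · simpa [ofSet, h] using isCompl_bot_top

theorem nonzero_ofSet {P : Set Q.V} {hP} {i : Q.V} (hi : i ∈ P) (hs : i ∈ V.supp) :
    (ofSet V P hP).toRep.Nonzero := by
  obtain ⟨x, hx⟩ := hs
  exact ⟨i, ⟨x, by simp [ofSet, hi]⟩, fun h => hx (congrArg Subtype.val h)⟩

end Subrep

/-- The support of an indecomposable representation of a tree quiver is
connected: any two vertices of the support are joined by a walk in the underlying graph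
all of whose vertices lie in the support. -/
theorem stmt3 (F : Type) [Field F] (Q : Quiv) (htree : Q.IsTree)
    (V : QRep F Q) (hInd : V.Indec) :
    ∀ i ∈ V.supp, ∀ j ∈ V.supp,
      Relation.ReflTransGen (fun u v => Q.Adj u v ∧ u ∈ V.supp ∧ v ∈ V.supp) i j := by
  intro i hi j hj
  by_contra hij
  let R : Q.V → Q.V → Prop := fun u v => Q.Adj u v ∧ u ∈ V.supp ∧ v ∈ V.supp
  let P : Set Q.V := {v | Relation.ReflTransGen R i v}
  have hP : ∀ a, Q.s a ∈ V.supp → Q.t a ∈ V.supp → Q.s a ∈ P → Q.t a ∈ P :=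
    fun a hs ht h => h.tail ⟨⟨a, .inl ⟨rfl, rfl⟩⟩, hs, ht⟩
  have hPc : ∀ a, Q.s a ∈ V.supp → Q.t a ∈ V.supp → Q.s a ∈ Pᶜ → Q.t a ∈ Pᶜ :=
    fun a hs ht h h' => h (h'.tail ⟨⟨a, .inr ⟨rfl, rfl⟩⟩, ht, hs⟩)
  exact hInd.2 (Subrep.ofSet V P hP).toRep (Subrep.ofSet V Pᶜ hPc).toRep
    (Subrep.nonzero_ofSet .refl hi) (Subrep.nonzero_ofSet hij hj)
    (Subrep.iso_dsum_of_isCompl _ _ (Subrep.isCompl_ofSet_compl P hP hPc))
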